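/- The mesh generating function φ of the Bakhvalov-type mesh satisfies: φ is twice continuously differentiable on [0,1] ∖ {1/2}, and there exists a constant C > 0 depending only on a, p, ε* such that for every ε ∈ (0, ε*], |φ'(t)| ≤ C for all t ∈ [0,1] and |φ''(t)| ≤ C for all t ∈ [0,1] ∖ {1/2}. -/

import Mathlib

/-- The boundary-layer part `κ(t) = aεt/(p-t)` of the Bakhvalov-type mesh generating
function. -/
noncomputable def bkappa (a ε p : ℝ) (t : ℝ) : ℝ := a * ε * t / (p - t)

/-- The coefficient `ω` of the cubic part, determined by `π(1/2) = 1/2`, where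
`α = p - ε^{1/3}`. -/
noncomputable def bomega (a ε p : ℝ) : ℝ :=
  (1 / 2 - (p - ε ^ ((1:ℝ)/3)))⁻¹ ^ 3 *
    (1 / 2 - a * (p * (1 / 2 - (p - ε ^ ((1:ℝ)/3))) ^ 2
      + p * (1 / 2 - (p - ε ^ ((1:ℝ)/3))) * ε ^ ((1:ℝ)/3)
      + (p - ε ^ ((1:ℝ)/3)) * ε ^ ((2:ℝ)/3)))

/-- The cubic part `π(t) = ω(t-α)³ + κ''(α)(t-α)²/2 + κ'(α)(t-α) + κ(α)`, with
`α = p - ε^{1/3}`, `κ'(α) = aεp/(p-α)²`, `κ''(α) = 2aεp/(p-α)³`. -/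
noncomputable def bpi (a ε p : ℝ) (t : ℝ) : ℝ :=
  bomega a ε p * (t - (p - ε ^ ((1:ℝ)/3))) ^ 3
    + (2 * a * ε * p / (p - (p - ε ^ ((1:ℝ)/3))) ^ 3) * (t - (p - ε ^ ((1:ℝ)/3))) ^ 2 / 2
    + (a * ε * p / (p - (p - ε ^ ((1:ℝ)/3))) ^ 2) * (t - (p - ε ^ ((1:ℝ)/3)))
    + bkappa a ε p (p - ε ^ ((1:ℝ)/3))

/-- The Bakhvalov-type mesh generating function: `φ = κ` on `[0, α]`, `φ = π` on
`[α, 1/2]`, and `φ(t) = 1 - φ(1-t)` on `[1/2, 1]`. -/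
noncomputable def bphi (a ε p : ℝ) (t : ℝ) : ℝ :=
  if t ≤ 1 / 2 then
    (if t ≤ p - ε ^ ((1:ℝ)/3) then bkappa a ε p t else bpi a ε p t)
  else
    1 - (if 1 - t ≤ p - ε ^ ((1:ℝ)/3) then bkappa a ε p (1 - t) else bpi a ε p (1 - t))

/-- Two functions whose values and derivatives match at `c` glue to a differentiable function. -/
theorem hasDerivAt_ite_le {f g f' g' : ℝ → ℝ} {c : ℝ}
    (hf : ∀ t ≤ c, HasDerivAt f (f' t) t) (hg : ∀ t, c ≤ t → HasDerivAt g (g' t) t)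
    (h0 : f c = g c) (h1 : f' c = g' c) (t : ℝ) :
    HasDerivAt (fun t => if t ≤ c then f t else g t) (if t ≤ c then f' t else g' t) t := by
  rcases lt_trichotomy t c with h | rfl | h
  · rw [if_pos h.le]
    refine (hf t h.le).congr_of_eventuallyEq ?_
    filter_upwards [Iio_mem_nhds h] with s hs
    exact if_pos (le_of_lt hs)
  · rw [if_pos le_rfl, ← hasDerivWithinAt_univ, ← Set.Iic_union_Ici (a := t)]
    refine HasDerivWithinAt.union ?_ ?_
    · refine (hf t le_rfl).hasDerivWithinAt.congr (fun s hs => if_pos hs) (if_pos le_rfl)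
    · rw [h1]
      have key : ∀ s ∈ Set.Ici t, (if s ≤ t then f s else g s) = g s := by
        intro s hs
        split_ifs with h
        · rw [le_antisymm h hs, h0]
        · rfl
      exact (hg t le_rfl).hasDerivWithinAt.congr key (key t Set.self_mem_Ici)
  · rw [if_neg h.not_ge]
    refine (hg t h.le).congr_of_eventuallyEq ?_
    filter_upwards [Ioi_mem_nhds h] with s hs
    exact if_neg (not_le_of_gt hs)

/-- A function with a continuous second derivative is `C²`. -/
theorem contDiff_two_of_hasDerivAt {f f' f'' : ℝ → ℝ} (hf : ∀ t, HasDerivAt f (f' t) t)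
    (hf' : ∀ t, HasDerivAt f' (f'' t) t) (hc : Continuous f'') : ContDiff ℝ 2 f := by
  have e : deriv f = f' := funext fun t => (hf t).deriv
  have e' : deriv f' = f'' := funext fun t => (hf' t).deriv
  rw [show (2 : WithTop ℕ∞) = 1 + 1 by norm_num, contDiff_succ_iff_deriv]
  refine ⟨fun t => (hf t).differentiableAt, by simp, ?_⟩
  rw [e, contDiff_one_iff_deriv, e']
  exact ⟨fun t => (hf' t).differentiableAt, hc⟩

/-- The point reflection of a `C²` function on `t ≤ 1/2` is `C²` away from `1/2`, with the same
bounds on its first two derivatives. -/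
theorem regularity_of_reflection {g g' g'' : ℝ → ℝ} {C : ℝ} (hC : 0 ≤ C)
    (hg : ∀ t, HasDerivAt g (g' t) t) (hg' : ∀ t, HasDerivAt g' (g'' t) t)
    (hc : Continuous g'') (b' : ∀ t ∈ Set.Icc (0 : ℝ) (1 / 2), |g' t| ≤ C)
    (b'' : ∀ t ∈ Set.Icc (0 : ℝ) (1 / 2), |g'' t| ≤ C) {φ : ℝ → ℝ}
    (hφ : ∀ t, φ t = if t ≤ 1 / 2 then g t else 1 - g (1 - t)) :
    ContDiffOn ℝ 2 φ (Set.Icc 0 1 \ {1/2}) ∧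
      (∀ t ∈ Set.Icc (0:ℝ) 1, |deriv φ t| ≤ C) ∧
      (∀ t ∈ Set.Icc (0:ℝ) 1 \ {(1:ℝ)/2}, |deriv (deriv φ) t| ≤ C) := by
  have hr (t : ℝ) : HasDerivAt (fun t => 1 - g (1 - t)) (g' (1 - t)) t := by
    simpa using ((hg (1 - t)).comp_const_sub 1 t).const_sub 1
  have hr' (t : ℝ) : HasDerivAt (fun t => g' (1 - t)) (-g'' (1 - t)) t :=
    (hg' (1 - t)).comp_const_sub 1 t
  have hl {t : ℝ} (ht : t < 1 / 2) : φ =ᶠ[nhds t] g := by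
    filter_upwards [Iio_mem_nhds ht] with s hs
    rw [hφ, if_pos (le_of_lt hs)]
  have hu {t : ℝ} (ht : 1 / 2 < t) : φ =ᶠ[nhds t] fun t => 1 - g (1 - t) := by
    filter_upwards [Ioi_mem_nhds ht] with s hs
    rw [hφ, if_neg (not_le_of_gt hs)]
  have hgd : deriv g = g' := funext fun t => (hg t).deriv
  have hrd : deriv (fun t => 1 - g (1 - t)) = fun t => g' (1 - t) :=
    funext fun t => (hr t).deriv
  refine ⟨?_, ?_, ?_⟩
  · rintro t ⟨-, ht⟩
    refine ContDiffAt.contDiffWithinAt ?_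
    rcases lt_or_gt_of_ne ht with h | h
    · exact (contDiff_two_of_hasDerivAt hg hg' hc).contDiffAt.congr_of_eventuallyEq (hl h)
    · have : ContDiff ℝ 2 (fun t => 1 - g (1 - t)) :=
        contDiff_two_of_hasDerivAt hr hr' (by fun_prop)
      exact this.contDiffAt.congr_of_eventuallyEq (hu h)
  · rintro t ⟨h0, h1⟩
    rcases lt_trichotomy t (1 / 2) with h | h | h
    · rw [(hl h).deriv_eq, hgd]
      exact b' t ⟨h0, h.le⟩
    · by_cases hd : DifferentiableAt ℝ φ t
      · have e : HasDerivWithinAt φ (g' t) (Set.Iic t) t := by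
          refine (hg t).hasDerivWithinAt.congr (fun s hs => ?_) ?_
          · rw [hφ, if_pos (hs.trans h.le)]
          · rw [hφ, if_pos h.le]
        rw [(uniqueDiffOn_Iic t t Set.self_mem_Iic).eq_deriv _
          hd.hasDerivAt.hasDerivWithinAt e]
        exact b' t ⟨h0, h.le⟩
      · rwa [deriv_zero_of_not_differentiableAt hd, abs_zero]
    · rw [(hu h).deriv_eq, hrd]
      exact b' (1 - t) ⟨by linarith, by linarith⟩
  · rintro t ⟨⟨h0, h1⟩, ht⟩
    rcases lt_or_gt_of_ne ht with h | h
    · rw [(hl h).deriv.deriv_eq, hgd, (hg' t).deriv]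
      exact b'' t ⟨h0, h.le⟩
    · rw [(hu h).deriv.deriv_eq, hrd, (hr' t).deriv, abs_neg]
      exact b'' (1 - t) ⟨by linarith, by linarith⟩

theorem hasDerivAt_bkappa (a ε : ℝ) {p t : ℝ} (ht : t < p) :
    HasDerivAt (bkappa a ε p) (a * ε * p / (p - t) ^ 2) t := by
  have hne : p - t ≠ 0 := (sub_pos.2 ht).ne'
  refine (((hasDerivAt_id t).const_mul (a * ε)).div
    ((hasDerivAt_id t).const_sub p) hne).congr_deriv ?_
  simp only [id]
  ring

theorem hasDerivAt_const_div_sub_sq (k : ℝ) {p t : ℝ} (ht : t < p) :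
    HasDerivAt (fun t => k / (p - t) ^ 2) (2 * k / (p - t) ^ 3) t := by
  have hne : p - t ≠ 0 := (sub_pos.2 ht).ne'
  refine ((hasDerivAt_const t k).div
    (((hasDerivAt_id t).const_sub p).pow 2) (pow_ne_zero 2 hne)).congr_deriv ?_
  simp only [id, Pi.pow_apply]
  field_simp
  ring

theorem hasDerivAt_cubic (w k₂ k₁ k₀ c t : ℝ) :
    HasDerivAt (fun t => w * (t - c) ^ 3 + k₂ * (t - c) ^ 2 / 2 + k₁ * (t - c) + k₀)
      (3 * w * (t - c) ^ 2 + k₂ * (t - c) + k₁) t := by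
  have h := (hasDerivAt_id t).sub_const c
  refine (((((h.pow 3).const_mul w).add (((h.pow 2).const_mul k₂).div_const 2)).add
    (h.const_mul k₁)).add_const k₀).congr_deriv ?_
  simp only [id]
  push_cast
  ring

theorem hasDerivAt_quadratic (w k₂ k₁ c t : ℝ) :
    HasDerivAt (fun t => 3 * w * (t - c) ^ 2 + k₂ * (t - c) + k₁)
      (6 * w * (t - c) + k₂) t := by
  have h := (hasDerivAt_id t).sub_const c
  refine ((((h.pow 2).const_mul (3 * w)).add (h.const_mul k₂)).add_const k₁).congr_deriv ?_
  simp only [id]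
  push_cast
  ring

theorem bomega_le {a ε p : ℝ} (ha : 0 ≤ a) (hε : 0 ≤ ε) (hp : p < 1 / 2)
    (hεp : ε ^ ((1:ℝ)/3) ≤ p) : bomega a ε p ≤ (1 / 2 - p)⁻¹ ^ 3 := by
  have hd : 0 ≤ ε ^ ((1:ℝ)/3) := Real.rpow_nonneg hε _
  have hd' : 0 ≤ ε ^ ((2:ℝ)/3) := Real.rpow_nonneg hε _
  unfold bomega
  generalize ε ^ ((1:ℝ)/3) = d at *
  generalize ε ^ ((2:ℝ)/3) = d₂ at *
  have hs : 0 < 1 / 2 - p := by linarith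
  have hs' : 0 < 1 / 2 - (p - d) := by linarith
  have hα : 0 ≤ p - d := by linarith
  have hp0 : 0 ≤ p := by linarith
  have hb : 0 ≤ a * (p * (1 / 2 - (p - d)) ^ 2 + p * (1 / 2 - (p - d)) * d + (p - d) * d₂) := by
    positivity
  calc _ ≤ (1 / 2 - (p - d))⁻¹ ^ 3 * 1 := by gcongr; linarith
    _ ≤ (1 / 2 - p)⁻¹ ^ 3 := by rw [mul_one]; gcongr; linarith

/-- The mesh generating function `φ` is twice continuously differentiable on
`[0,1] ∖ {1/2}`, with first derivative bounded on `[0,1]` and second derivative bounded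
on `[0,1] ∖ {1/2}`, uniformly in `ε`. -/
theorem bakhvalov_phi_regularity
    (εstar p a : ℝ)
    (hεstar : εstar ∈ Set.Ioo (0:ℝ) (1/8))
    (hp : p ∈ Set.Ioo (εstar ^ ((1:ℝ)/3)) (1/2))
    (ha : 0 < a)
    (hω : ∀ ε ∈ Set.Ioc (0:ℝ) εstar, 0 ≤ bomega a ε p) :
    ∃ C > 0, ∀ ε ∈ Set.Ioc (0:ℝ) εstar,
      ContDiffOn ℝ 2 (bphi a ε p) (Set.Icc 0 1 \ {1/2}) ∧
      (∀ t ∈ Set.Icc (0:ℝ) 1, |deriv (bphi a ε p) t| ≤ C) ∧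
      (∀ t ∈ Set.Icc (0:ℝ) 1 \ {(1:ℝ)/2}, |deriv (deriv (bphi a ε p)) t| ≤ C) := by
  obtain ⟨hp1, hp2⟩ := hp
  have hs : 0 < 1 / 2 - p := by linarith
  refine ⟨6 * (1 / 2 - p)⁻¹ ^ 3 + 4 * a, by positivity, fun ε hε => ?_⟩
  have hεp : ε ^ ((1:ℝ)/3) < p :=
    (Real.rpow_le_rpow hε.1.le hε.2 (by norm_num)).trans_lt hp1
  have hw := bomega_le ha.le hε.1.le hp2 hεp.le
  have hw0 := hω ε hε
  have hd : 0 < ε ^ ((1:ℝ)/3) := Real.rpow_pos_of_pos hε.1 _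
  have hd3 : ε = (ε ^ ((1:ℝ)/3)) ^ 3 := by
    rw [← Real.rpow_natCast, ← Real.rpow_mul hε.1.le]; norm_num
  have hφ : ∀ t, bphi a ε p t = if t ≤ 1 / 2 then
      (fun t => if t ≤ p - ε ^ ((1:ℝ)/3) then bkappa a ε p t else bpi a ε p t) t else
      1 - (fun t => if t ≤ p - ε ^ ((1:ℝ)/3) then bkappa a ε p t else bpi a ε p t) (1 - t) :=
    fun _ => rfl
  unfold bpi at hφ
  generalize ε ^ ((1:ℝ)/3) = d at *
  generalize bomega a ε p = w at *
  generalize (1 / 2 - p)⁻¹ ^ 3 = W at *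
  obtain ⟨c, rfl⟩ : ∃ c, d = p - c := ⟨p - d, by ring⟩
  simp only [sub_sub_cancel] at hφ
  have hcp : c < p := by linarith
  have hk₁ : a * ε * p / (p - c) ^ 2 = a * p * (p - c) := by
    rw [div_eq_iff (by positivity)]; linear_combination a * p * hd3
  have hk₂ : 2 * a * ε * p / (p - c) ^ 3 = 2 * a * p := by
    rw [div_eq_iff (by positivity)]; linear_combination 2 * a * p * hd3
  have hp0 : 0 < p := by linarith
  have hε0 := hε.1
  have hk₁a : a * p * (p - c) ≤ a := by
    have : p * (p - c) ≤ 1 := by nlinarith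
    nlinarith
  have hk₂a : 2 * a * p ≤ a := by nlinarith
  refine regularity_of_reflection (by linarith)
    (hasDerivAt_ite_le (fun t ht => hasDerivAt_bkappa a ε (ht.trans_lt hcp))
      (fun t _ => hasDerivAt_cubic _ _ _ _ _ t) (by simp) (by simp))
    (hasDerivAt_ite_le (fun t ht => hasDerivAt_const_div_sub_sq (a * ε * p) (ht.trans_lt hcp))
      (fun t _ => hasDerivAt_quadratic _ _ _ _ t) (by simp) (by simp; ring)) ?_ ?_ ?_ hφ
  · refine continuous_if_le continuous_id continuous_const ?_ (by fun_prop) ?_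
    · refine ContinuousOn.div (by fun_prop) (by fun_prop) fun t ht => ?_
      exact pow_ne_zero 3 (sub_pos.2 (lt_of_le_of_lt ht hcp)).ne'
    · rintro t rfl
      simp only [sub_self]
      ring
  · rintro t ⟨h0, h1⟩
    split_ifs with h
    · have hpt : p - c ≤ p - t := by linarith
      rw [abs_of_nonneg (by positivity)]
      calc _ ≤ a * ε * p / (p - c) ^ 2 := by gcongr
        _ ≤ _ := by rw [hk₁]; linarith
    · have ht0 : 0 ≤ t - c := by linarith
      have ht1 : t - c ≤ 1 := by linarith
      rw [hk₁, hk₂, abs_of_nonneg (by positivity)]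
      have e₁ : w * (t - c) ^ 2 ≤ w * 1 := by gcongr; exact pow_le_one₀ ht0 ht1
      have e₂ : 2 * a * p * (t - c) ≤ 2 * a * p * 1 := by gcongr
      linarith
  · rintro t ⟨h0, h1⟩
    split_ifs with h
    · have hpt : p - c ≤ p - t := by linarith
      have hpt0 : 0 < p - t := by linarith
      rw [abs_of_nonneg (by positivity)]
      calc _ ≤ 2 * (a * ε * p) / (p - c) ^ 3 := by gcongr
        _ = 2 * a * p := by rw [← hk₂]; ring
        _ ≤ _ := by linarith
    · have ht0 : 0 ≤ t - c := by linarith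
      have ht1 : t - c ≤ 1 := by linarith
      rw [hk₂, abs_of_nonneg (by positivity)]
      have e₁ : w * (t - c) ≤ w * 1 := by gcongr
      linarith
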